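/- arXiv:1907.11577 — 10 statements merged into one kernel-verified Lean document; each statement's English description precedes it below -/
import Mathlib

section
/- Let B : Matrix n m ℝ and C : Matrix m p ℝ be real matrices with B * C = 0. If v ∈ ℝ^m satisfies (Bᵀ * B).mulVec v = λ • v with λ ≠ 0, and w ∈ ℝ^m satisfies (C * Cᵀ).mulVec w = μ • w with μ ≠ 0, then ⟪v, w⟫ = 0. (Proposition 1, part 1: eigenvectors associated with nonzero eigenvalues of BᵀₖBₖ are orthogonal to eigenvectors associated with nonzero eigenvalues of B_{k+1}B_{k+1}ᵀ.) -/
open Matrix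

/-- Proposition 1, part 1: eigenvectors associated with nonzero eigenvalues of `BᵀB`
are orthogonal to eigenvectors associated with nonzero eigenvalues of `CCᵀ`,
whenever `B * C = 0`. -/
theorem prop1_part1 {n m p : Type*} [Fintype n] [Fintype m] [Fintype p]
    (B : Matrix n m ℝ) (C : Matrix m p ℝ) (hBC : B * C = 0)
    (v w : m → ℝ) (lam mu : ℝ) (hlam : lam ≠ 0) (hmu : mu ≠ 0)
    (hv : (Bᵀ * B).mulVec v = lam • v)
    (hw : (C * Cᵀ).mulVec w = mu • w) :
    v ⬝ᵥ w = 0 := by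
  have hBw : B *ᵥ w = 0 := by
    have h : mu • (B *ᵥ w) = 0 := by
      rw [← mulVec_smul, ← hw, mulVec_mulVec, ← Matrix.mul_assoc, hBC, Matrix.zero_mul,
        zero_mulVec]
    exact (smul_eq_zero.mp h).resolve_left hmu
  have h : lam • (w ⬝ᵥ v) = 0 := by
    rw [← dotProduct_smul, ← hv, ← mulVec_mulVec, dotProduct_mulVec, vecMul_transpose, hBw,
      zero_dotProduct]
  rw [dotProduct_comm]
  exact (smul_eq_zero.mp h).resolve_left hlam
end

section
/- Let B : Matrix n m ℝ and C : Matrix m p ℝ satisfy B * C = 0, and set L := Bᵀ * B + C * Cᵀ. If v ∈ ℝ^m satisfies L.mulVec v = λ • v with λ ≠ 0, then, defining v₁ := λ⁻¹ • (Bᵀ * B).mulVec v and v₂ := λ⁻¹ • (C * Cᵀ).mulVec v, one has v = v₁ + v₂, (Bᵀ * B).mulVec v₁ = λ • v₁, and (C * Cᵀ).mulVec v₂ = λ • v₂. (Proposition 1, part 3: every eigenvector of the k-th order Laplacian Lₖ for a nonzero eigenvalue decomposes into λ-eigenvectors (possibly zero) of BᵀₖBₖ and of B_{k+1}B_{k+1}ᵀ.)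 -/
open Matrix

/-- If `P * Q = 0` and `v` is a `μ`-eigenvector of `P + Q`, then `P *ᵥ v` satisfies the
`μ`-eigenvector equation for `P`. -/
theorem mulVec_mulVec_eq_smul_of_mul_eq_zero {m R : Type*} [Fintype m] [CommRing R]
    {P Q : Matrix m m R} (hPQ : P * Q = 0) {v : m → R} {μ : R}
    (hv : (P + Q).mulVec v = μ • v) :
    P.mulVec (P.mulVec v) = μ • P.mulVec v := by
  rw [← mulVec_smul, ← hv, mulVec_mulVec, mulVec_mulVec, mul_add, hPQ, add_zero]

/-- Proposition 1, part 3: every eigenvector of the Laplacian `L = Bᵀ B + C Cᵀ` for a nonzero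
eigenvalue decomposes into `λ`-eigenvectors (possibly zero) of `Bᵀ B` and of `C Cᵀ`. -/
theorem prop1_part3 {n m p : Type*} [Fintype n] [Fintype m] [Fintype p]
    (B : Matrix n m ℝ) (C : Matrix m p ℝ) (hBC : B * C = 0)
    (v : m → ℝ) (lam : ℝ) (hlam : lam ≠ 0)
    (hv : (Bᵀ * B + C * Cᵀ).mulVec v = lam • v) :
    v = lam⁻¹ • (Bᵀ * B).mulVec v + lam⁻¹ • (C * Cᵀ).mulVec v ∧
    (Bᵀ * B).mulVec (lam⁻¹ • (Bᵀ * B).mulVec v) = lam • (lam⁻¹ • (Bᵀ * B).mulVec v) ∧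
    (C * Cᵀ).mulVec (lam⁻¹ • (C * Cᵀ).mulVec v) = lam • (lam⁻¹ • (C * Cᵀ).mulVec v) := by
  have hPQ : Bᵀ * B * (C * Cᵀ) = 0 := by
    rw [Matrix.mul_assoc, ← Matrix.mul_assoc B, hBC, Matrix.zero_mul, Matrix.mul_zero]
  have hQP : C * Cᵀ * (Bᵀ * B) = 0 := by
    simpa [transpose_mul] using congrArg transpose hPQ
  refine ⟨?_, ?_, ?_⟩
  · rw [← smul_add, ← add_mulVec, hv, inv_smul_smul₀ hlam]
  · rw [mulVec_smul, mulVec_mulVec_eq_smul_of_mul_eq_zero hPQ hv, smul_comm]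
  · rw [mulVec_smul, mulVec_mulVec_eq_smul_of_mul_eq_zero hQP (by rwa [add_comm]), smul_comm]
end

section
/- Let B : Matrix n m ℝ and C : Matrix m p ℝ satisfy B * C = 0, and set L := Bᵀ * B + C * Cᵀ. For every λ ≠ 0: there exists a nonzero v ∈ ℝ^m with L.mulVec v = λ • v if and only if there exists a nonzero v with (Bᵀ * B).mulVec v = λ • v or there exists a nonzero v with (C * Cᵀ).mulVec v = λ • v. (Proposition 1, part 4: the nonzero eigenvalues of Lₖ are exactly the nonzero eigenvalues of BᵀₖBₖ together with those of B_{k+1}B_{k+1}ᵀ.) -/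
open Matrix

/-- If `P * Q = 0` and `Q * P = 0`, the nonzero eigenvalues of `P + Q` are exactly the nonzero
eigenvalues of `P` together with those of `Q`. -/
theorem Matrix.exists_add_mulVec_eq_smul_iff {m K : Type*} [Fintype m] [Field K]
    {P Q : Matrix m m K} (hPQ : P * Q = 0) (hQP : Q * P = 0) {c : K} (hc : c ≠ 0) :
    (∃ v : m → K, v ≠ 0 ∧ (P + Q).mulVec v = c • v) ↔
      ((∃ v : m → K, v ≠ 0 ∧ P.mulVec v = c • v) ∨
       (∃ v : m → K, v ≠ 0 ∧ Q.mulVec v = c • v)) := by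
  have eq_zero {R S : Matrix m m K} (hSR : S * R = 0) {v : m → K}
      (hv : R.mulVec v = c • v) : S.mulVec v = 0 := by
    have h : c • S.mulVec v = 0 := by
      rw [← mulVec_smul, ← hv, mulVec_mulVec, hSR, zero_mulVec]
    exact (smul_eq_zero.mp h).resolve_left hc
  constructor
  · rintro ⟨v, hv, h⟩
    by_cases hP : P.mulVec v = 0
    · exact Or.inr ⟨v, hv, by rwa [add_mulVec, hP, zero_add] at h⟩
    · refine Or.inl ⟨P.mulVec v, hP, ?_⟩
      rw [← mulVec_smul, ← h, mulVec_mulVec, mulVec_mulVec, mul_add, hPQ, add_zero]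
  · rintro (⟨v, hv, h⟩ | ⟨v, hv, h⟩)
    · exact ⟨v, hv, by rw [add_mulVec, h, eq_zero hQP h, add_zero]⟩
    · exact ⟨v, hv, by rw [add_mulVec, h, eq_zero hPQ h, zero_add]⟩

/-- Proposition 1, part 4: the nonzero eigenvalues of `L = Bᵀ B + C Cᵀ` are exactly the
nonzero eigenvalues of `Bᵀ B` together with those of `C Cᵀ`, when `B * C = 0`. -/
theorem prop1_part4 {n m p : Type*} [Fintype n] [Fintype m] [Fintype p]
    (B : Matrix n m ℝ) (C : Matrix m p ℝ) (hBC : B * C = 0)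
    (lam : ℝ) (hlam : lam ≠ 0) :
    (∃ v : m → ℝ, v ≠ 0 ∧ (Bᵀ * B + C * Cᵀ).mulVec v = lam • v) ↔
      ((∃ v : m → ℝ, v ≠ 0 ∧ (Bᵀ * B).mulVec v = lam • v) ∨
       (∃ v : m → ℝ, v ≠ 0 ∧ (C * Cᵀ).mulVec v = lam • v)) := by
  have hCB : Cᵀ * Bᵀ = 0 := by rw [← transpose_mul, hBC, transpose_zero]
  refine exists_add_mulVec_eq_smul_iff ?_ ?_ hlam
  · rw [Matrix.mul_assoc, ← Matrix.mul_assoc B, hBC, Matrix.zero_mul, Matrix.mul_zero]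
  · rw [Matrix.mul_assoc, ← Matrix.mul_assoc Cᵀ, hCB, Matrix.zero_mul, Matrix.mul_zero]
end

section
/- Hodge decomposition: let B₁ : Matrix V E ℝ and B₂ : Matrix E T ℝ satisfy B₁ * B₂ = 0, and L₁ := B₁ᵀ * B₁ + B₂ * B₂ᵀ. Consider the submodules of ℝ^E: W_irr := range of the linear map a ↦ B₁ᵀ.mulVec a (a ∈ ℝ^V), W_sol := range of the linear map b ↦ B₂.mulVec b (b ∈ ℝ^T), and W_H := {s : L₁.mulVec s = 0}. Then W_irr, W_sol, W_H are pairwise orthogonal with respect to the standard inner product, and W_irr ⊔ W_H ⊔ W_sol = ⊤ (their sum is all of ℝ^E). -/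
open Matrix

theorem Matrix.IsSymm.range_sup_ker_mulVecLin {n : Type*} [Fintype n] {M : Matrix n n ℝ}
    (hM : M.IsSymm) : LinearMap.range M.mulVecLin ⊔ LinearMap.ker M.mulVecLin = ⊤ := by
  refine Submodule.eq_top_of_disjoint _ _ (LinearMap.finrank_range_add_finrank_ker _).ge ?_
  rw [Submodule.disjoint_def]
  rintro _ ⟨y, rfl⟩ hy
  have hker := Matrix.ker_mulVecLin_transpose_mul_self M
  rw [hM.eq] at hker
  have hy' : y ∈ LinearMap.ker (M * M).mulVecLin := by
    simpa using hy
  rwa [hker, LinearMap.mem_ker] at hy'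

theorem Matrix.mulVec_eq_zero_of_transpose_mul_self_add_mul_transpose
    {V E T : Type*} [Fintype V] [Fintype E] [Fintype T]
    {B₁ : Matrix V E ℝ} {B₂ : Matrix E T ℝ} {y : E → ℝ}
    (hy : (B₁ᵀ * B₁ + B₂ * B₂ᵀ) *ᵥ y = 0) : B₁ *ᵥ y = 0 ∧ B₂ᵀ *ᵥ y = 0 := by
  have hsum : (B₁ *ᵥ y) ⬝ᵥ (B₁ *ᵥ y) + (B₂ᵀ *ᵥ y) ⬝ᵥ (B₂ᵀ *ᵥ y) = 0 := by
    have := congrArg (y ⬝ᵥ ·) hy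
    simpa [add_mulVec, ← mulVec_mulVec, dotProduct_mulVec, vecMul_transpose,
      ← mulVec_transpose] using this
  have h₁ : 0 ≤ (B₁ *ᵥ y) ⬝ᵥ (B₁ *ᵥ y) := Finset.sum_nonneg fun _ _ => mul_self_nonneg _
  have h₂ : 0 ≤ (B₂ᵀ *ᵥ y) ⬝ᵥ (B₂ᵀ *ᵥ y) := Finset.sum_nonneg fun _ _ => mul_self_nonneg _
  exact ⟨dotProduct_self_eq_zero.mp (by linarith), dotProduct_self_eq_zero.mp (by linarith)⟩

/-- Hodge decomposition: the irrotational subspace `img B₁ᵀ`, the harmonic subspace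
`ker L₁`, and the solenoidal subspace `img B₂` are pairwise orthogonal and their sum
is the whole edge-signal space `ℝ^E`. -/
theorem hodge_decomposition {V E T : Type*} [Fintype V] [Fintype E] [Fintype T]
    (B₁ : Matrix V E ℝ) (B₂ : Matrix E T ℝ) (h : B₁ * B₂ = 0) :
    let L₁ := B₁ᵀ * B₁ + B₂ * B₂ᵀ
    let Wirr := LinearMap.range B₁ᵀ.mulVecLin
    let Wsol := LinearMap.range B₂.mulVecLin
    let WH := LinearMap.ker L₁.mulVecLin
    (∀ x ∈ Wirr, ∀ y ∈ Wsol, x ⬝ᵥ y = 0) ∧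
    (∀ x ∈ Wirr, ∀ y ∈ WH, x ⬝ᵥ y = 0) ∧
    (∀ x ∈ Wsol, ∀ y ∈ WH, x ⬝ᵥ y = 0) ∧
    Wirr ⊔ WH ⊔ Wsol = ⊤ := by
  intro L₁ Wirr Wsol WH
  refine ⟨?_, ?_, ?_, ?_⟩
  · rintro _ ⟨a, rfl⟩ _ ⟨b, rfl⟩
    rw [mulVecLin_apply, mulVecLin_apply, mulVec_transpose, ← dotProduct_mulVec, mulVec_mulVec, h,
      zero_mulVec, dotProduct_zero]
  · rintro _ ⟨a, rfl⟩ y hy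
    rw [mulVecLin_apply, mulVec_transpose, ← dotProduct_mulVec,
      (mulVec_eq_zero_of_transpose_mul_self_add_mul_transpose hy).1, dotProduct_zero]
  · rintro _ ⟨b, rfl⟩ y hy
    rw [mulVecLin_apply, ← vecMul_transpose, ← dotProduct_mulVec,
      (mulVec_eq_zero_of_transpose_mul_self_add_mul_transpose hy).2, dotProduct_zero]
  · have hL : L₁.IsSymm := by
      simp [L₁, IsSymm, transpose_add, transpose_mul]
    rw [eq_top_iff, ← hL.range_sup_ker_mulVecLin]
    refine sup_le ?_ (le_sup_right.trans le_sup_left)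
    rintro _ ⟨x, rfl⟩
    rw [mulVecLin_apply, add_mulVec, ← mulVec_mulVec, ← mulVec_mulVec]
    exact add_mem (Submodule.mem_sup_left (Submodule.mem_sup_left ⟨_, rfl⟩))
      (Submodule.mem_sup_right ⟨_, rfl⟩)
end

section
/- Let B₁ : Matrix V E ℝ and B₂ : Matrix E T ℝ satisfy B₁ * B₂ = 0, and L₁ := B₁ᵀ * B₁ + B₂ * B₂ᵀ. Then every edge signal s¹ ∈ ℝ^E can be written as a sum of three pairwise orthogonal components: there exist s⁰ ∈ ℝ^V, s_H ∈ ℝ^E, and s² ∈ ℝ^T such that s¹ = B₁ᵀ.mulVec s⁰ + s_H + B₂.mulVec s², L₁.mulVec s_H = 0, and the three vectors B₁ᵀ.mulVec s⁰, s_H, B₂.mulVec s² are pairwise orthogonal. -/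
open Matrix

/-- The normal equations of a real least squares problem are solvable. -/
theorem Matrix.exists_transpose_mulVec_sub_mulVec_eq_zero {m n : Type*} [Fintype m] [Fintype n]
    (A : Matrix m n ℝ) (x : m → ℝ) : ∃ y : n → ℝ, Aᵀ *ᵥ (x - A *ᵥ y) = 0 := by
  have hle : LinearMap.range (Aᵀ * A).mulVecLin ≤ LinearMap.range Aᵀ.mulVecLin := by
    rw [mulVecLin_mul]
    exact LinearMap.range_comp_le_range _ _
  have hrank : (Aᵀ * A).rank = Aᵀ.rank := by
    rw [rank_transpose_mul_self, rank_transpose]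
  have hmem : Aᵀ *ᵥ x ∈ LinearMap.range (Aᵀ * A).mulVecLin := by
    rw [Submodule.eq_of_le_of_finrank_eq hle hrank]
    exact ⟨x, rfl⟩
  obtain ⟨y, hy⟩ := hmem
  refine ⟨y, ?_⟩
  rw [mulVec_sub, mulVec_mulVec, sub_eq_zero]
  exact hy.symm

/-- Hodge decomposition of edge signals: every `s¹ ∈ ℝ^E` is the sum of an irrotational,
a harmonic and a solenoidal component, pairwise orthogonal. -/
theorem hodge_decomposition_of_signal {V E T : Type*} [Fintype V] [Fintype E] [Fintype T]
    (B₁ : Matrix V E ℝ) (B₂ : Matrix E T ℝ) (h : B₁ * B₂ = 0) (s1 : E → ℝ) :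
    ∃ (s0 : V → ℝ) (sH : E → ℝ) (s2 : T → ℝ),
      s1 = B₁ᵀ.mulVec s0 + sH + B₂.mulVec s2 ∧
      (B₁ᵀ * B₁ + B₂ * B₂ᵀ).mulVec sH = 0 ∧
      (B₁ᵀ.mulVec s0) ⬝ᵥ sH = 0 ∧
      (B₁ᵀ.mulVec s0) ⬝ᵥ (B₂.mulVec s2) = 0 ∧
      sH ⬝ᵥ (B₂.mulVec s2) = 0 := by
  obtain ⟨s0, h0⟩ := B₁ᵀ.exists_transpose_mulVec_sub_mulVec_eq_zero s1
  obtain ⟨s2, h2⟩ := B₂.exists_transpose_mulVec_sub_mulVec_eq_zero s1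
  rw [transpose_transpose] at h0
  have h' : B₂ᵀ * B₁ᵀ = 0 := by rw [← transpose_mul, h, transpose_zero]
  have hB₁ : B₁ *ᵥ (s1 - B₁ᵀ *ᵥ s0 - B₂ *ᵥ s2) = 0 := by
    rw [mulVec_sub, h0, mulVec_mulVec, h, zero_mulVec, sub_zero]
  have hB₂ : B₂ᵀ *ᵥ (s1 - B₁ᵀ *ᵥ s0 - B₂ *ᵥ s2) = 0 := by
    rw [sub_right_comm, mulVec_sub, h2, mulVec_mulVec, h', zero_mulVec, sub_zero]
  refine ⟨s0, s1 - B₁ᵀ *ᵥ s0 - B₂ *ᵥ s2, s2, by abel, ?_, ?_, ?_, ?_⟩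
  · rw [add_mulVec, ← mulVec_mulVec, ← mulVec_mulVec, hB₁, hB₂, mulVec_zero, mulVec_zero, add_zero]
  · rw [dotProduct_comm, dotProduct_mulVec, vecMul_transpose, hB₁, zero_dotProduct]
  · rw [mulVec_transpose, ← dotProduct_mulVec, mulVec_mulVec, h, zero_mulVec, dotProduct_zero]
  · rw [dotProduct_mulVec, ← mulVec_transpose, hB₂, zero_dotProduct]
end

section
/- Theorem 2 (sampling condition): let P : Matrix E E ℝ be symmetric and idempotent (P = Pᵀ and P * P = P, an orthogonal projection, the bandlimiting operator F_𝓕), and let D : Matrix E E ℝ be a diagonal matrix each of whose diagonal entries is 0 or 1 (the sampling operator D_𝒮). Then the ℓ²-operator norm of (1 − D) * P is strictly less than 1 if and only if the only vector s ∈ ℝ^E with P.mulVec s = s and D.mulVec s = 0 is s = 0, i.e., if and only if no nonzero P-bandlimited signal is perfectly localized on the complement of the sampling set. -/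
open Matrix

/-- The ℓ²-operator norm of a real square matrix, i.e. the operator norm of the induced
linear map on the corresponding Euclidean space. -/
noncomputable def l2OpNorm {ι : Type*} [Fintype ι] [DecidableEq ι] (M : Matrix ι ι ℝ) : ℝ :=
  ‖LinearMap.toContinuousLinearMap (Matrix.toEuclideanLin M)‖

/-- A linear map on a finite-dimensional real space has operator norm less than one as soon as it
strictly shrinks every nonzero vector. -/
theorem ContinuousLinearMap.norm_lt_one_of_forall_norm_lt {V W : Type*} [NormedAddCommGroup V]
    [NormedSpace ℝ V] [FiniteDimensional ℝ V] [NormedAddCommGroup W] [NormedSpace ℝ W]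
    (T : V →L[ℝ] W) (h : ∀ x, x ≠ 0 → ‖T x‖ < ‖x‖) : ‖T‖ < 1 := by
  have : ProperSpace V := FiniteDimensional.proper ℝ V
  obtain ⟨x₀, hx₀, hmax⟩ := (isCompact_closedBall (0 : V) 1).exists_isMaxOn
    ⟨0, by simp⟩ (f := fun x => ‖T x‖) (by fun_prop)
  have hle : ‖T‖ ≤ ‖T x₀‖ := T.opNorm_le_of_unit_norm (norm_nonneg _) fun x hx =>
    hmax (by simp [hx])
  refine hle.trans_lt ?_
  rcases eq_or_ne x₀ 0 with rfl | hne
  · simp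
  · exact (h x₀ hne).trans_le (by simpa using hx₀)

/-- The Pythagorean identity for an orthogonal projection matrix. -/
theorem Matrix.dotProduct_self_eq_add_of_symm_of_idem {ι : Type*} [Fintype ι]
    {Q : Matrix ι ι ℝ} (hsym : Qᵀ = Q) (hidem : Q * Q = Q) (v : ι → ℝ) :
    v ⬝ᵥ v = Q *ᵥ v ⬝ᵥ Q *ᵥ v + (v - Q *ᵥ v) ⬝ᵥ (v - Q *ᵥ v) := by
  have h : Q *ᵥ v ⬝ᵥ Q *ᵥ v = v ⬝ᵥ Q *ᵥ v := by
    rw [dotProduct_mulVec, ← mulVec_transpose, hsym, mulVec_mulVec, hidem, dotProduct_comm]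
  simp only [sub_dotProduct, dotProduct_sub, h, dotProduct_comm (Q *ᵥ v) v]
  ring

/-- Theorem 2 (sampling condition): `‖(I − D) P‖₂ < 1` iff no nonzero `P`-bandlimited signal
is perfectly localized on the complement of the sampling set. -/
theorem sampling_condition {E : Type*} [Fintype E] [DecidableEq E]
    (P D : Matrix E E ℝ) (hPsym : Pᵀ = P) (hPP : P * P = P)
    (hDdiag : ∀ i j, i ≠ j → D i j = 0) (hD01 : ∀ i, D i i = 0 ∨ D i i = 1) :
    l2OpNorm ((1 - D) * P) < 1 ↔
      ∀ s : E → ℝ, P.mulVec s = s → D.mulVec s = 0 → s = 0 := by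
  have hDsym : Dᵀ = D := by
    ext i j
    rcases eq_or_ne i j with rfl | hij
    · rfl
    · rw [transpose_apply, hDdiag i j hij, hDdiag j i hij.symm]
  have hDD : D * D = D := by
    ext i j
    rw [mul_apply, Finset.sum_eq_single i (fun k _ hk => by rw [hDdiag i k hk.symm, zero_mul])
      (by simp)]
    rcases eq_or_ne i j with rfl | hij
    · rcases hD01 i with h | h <;> simp [h]
    · simp [hDdiag i j hij]
  have hT (s : E → ℝ) : ((1 - D) * P) *ᵥ s = P *ᵥ s - D *ᵥ (P *ᵥ s) := by
    rw [← mulVec_mulVec, sub_mulVec, one_mulVec]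
  constructor
  · intro h s hP hD
    by_contra hs
    have hle := (LinearMap.toContinuousLinearMap (toEuclideanLin ((1 - D) * P))).le_opNorm
      (WithLp.toLp 2 s)
    have hfix : LinearMap.toContinuousLinearMap (toEuclideanLin ((1 - D) * P)) (WithLp.toLp 2 s)
        = WithLp.toLp 2 s := by
      rw [LinearMap.coe_toContinuousLinearMap', toLpLin_apply, hT, hP, hD, sub_zero]
    rw [hfix] at hle
    have hpos : 0 < ‖WithLp.toLp 2 s‖ := norm_pos_iff.mpr (by simpa using hs)
    unfold l2OpNorm at h
    nlinarith
  · intro h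
    refine ContinuousLinearMap.norm_lt_one_of_forall_norm_lt _ fun x hx => ?_
    by_contra! hle
    have hsq := pow_le_pow_left₀ (norm_nonneg _) hle 2
    have hnorm (y : EuclideanSpace ℝ E) : ‖y‖ ^ 2 = y.ofLp ⬝ᵥ y.ofLp := by
      rw [EuclideanSpace.real_norm_sq_eq]
      simp only [dotProduct, sq]
    rw [hnorm, hnorm] at hsq
    simp only [LinearMap.coe_toContinuousLinearMap', toLpLin_apply, hT] at hsq
    have hnonneg (v : E → ℝ) : 0 ≤ v ⬝ᵥ v :=
      Finset.sum_nonneg fun i _ => mul_self_nonneg (v i)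
    have h₁ := dotProduct_self_eq_add_of_symm_of_idem hPsym hPP x.ofLp
    have h₂ := dotProduct_self_eq_add_of_symm_of_idem hDsym hDD (P *ᵥ x.ofLp)
    have h₃ := hnonneg (x.ofLp - P *ᵥ x.ofLp)
    have h₄ := hnonneg (D *ᵥ (P *ᵥ x.ofLp))
    have hP : P *ᵥ x.ofLp = x.ofLp :=
      (sub_eq_zero.mp (dotProduct_self_eq_zero.mp (by linarith))).symm
    have hD : D *ᵥ (P *ᵥ x.ofLp) = 0 := dotProduct_self_eq_zero.mp (by linarith)
    rw [hP] at hD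
    exact hx (by simpa using h x.ofLp hP hD)
end

section
/- Theorem 2 (recovery formula): let P : Matrix E E ℝ and D : Matrix E E ℝ be as above, and suppose the ℓ²-operator norm of (1 − D) * P is strictly less than 1. Then the matrix 1 − (1 − D) * P is invertible, and every P-bandlimited signal can be perfectly recovered from its samples: for every s ∈ ℝ^E with P.mulVec s = s, one has s = (1 − (1 − D) * P)⁻¹.mulVec (D.mulVec s). -/
open Matrix

theorem isUnit_one_sub_of_l2OpNorm_lt_one {ι : Type*} [Fintype ι] [DecidableEq ι]
    {M : Matrix ι ι ℝ} (hM : l2OpNorm M < 1) : IsUnit (1 - M) := by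
  have h : IsUnit (1 - Matrix.toEuclideanCLM (n := ι) (𝕜 := ℝ) M) :=
    isUnit_one_sub_of_norm_lt_one hM
  rw [← map_one (Matrix.toEuclideanCLM (n := ι) (𝕜 := ℝ)), ← map_sub] at h
  exact (isUnit_map_iff (Matrix.toEuclideanCLM (n := ι) (𝕜 := ℝ)) _).mp h

/-- Theorem 2 (recovery formula): if `‖(I − D) P‖₂ < 1` then `I − (I − D) P` is invertible
and every `P`-bandlimited signal is perfectly recovered from its samples. -/
theorem sampling_recovery {E : Type*} [Fintype E] [DecidableEq E]
    (P D : Matrix E E ℝ) (hPsym : Pᵀ = P) (hPP : P * P = P)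
    (hDdiag : ∀ i j, i ≠ j → D i j = 0) (hD01 : ∀ i, D i i = 0 ∨ D i i = 1)
    (hnorm : l2OpNorm ((1 - D) * P) < 1) :
    IsUnit (1 - (1 - D) * P) ∧
    ∀ s : E → ℝ, P.mulVec s = s →
      s = (1 - (1 - D) * P)⁻¹.mulVec (D.mulVec s) := by
  have hU := isUnit_one_sub_of_l2OpNorm_lt_one hnorm
  refine ⟨hU, fun s hs => ?_⟩
  have hD : (1 - (1 - D) * P).mulVec s = D.mulVec s := by
    rw [Matrix.sub_mulVec, ← Matrix.mulVec_mulVec, hs, Matrix.sub_mulVec, Matrix.one_mulVec,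
      sub_sub_cancel]
  rw [← hD, Matrix.mulVec_mulVec,
    Matrix.nonsing_inv_mul _ ((Matrix.isUnit_iff_isUnit_det _).mp hU), Matrix.one_mulVec]
end

section
/- Let B₁ : Matrix V E ℝ and B₂ : Matrix E T ℝ satisfy B₁ * B₂ = 0, and L₁ := B₁ᵀ * B₁ + B₂ * B₂ᵀ. If u ∈ ℝ^V is nonzero and satisfies (B₁ * B₁ᵀ).mulVec u = λ • u with λ ≠ 0, then v := B₁ᵀ.mulVec u is nonzero and satisfies L₁.mulVec v = λ • v; that is, B₁ᵀ u is an eigenvector of the full first-order Hodge Laplacian L₁ for the same eigenvalue λ, lying in the irrotational subspace. (Key step in the proof of Proposition 2.) -/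
open Matrix

/-- Key step of Proposition 2: if `u` is an eigenvector of the graph Laplacian `B₁ B₁ᵀ`
for a nonzero eigenvalue `λ`, then `B₁ᵀ u` is an eigenvector of the full first-order
Hodge Laplacian `L₁ = B₁ᵀ B₁ + B₂ B₂ᵀ` for the same eigenvalue. -/
theorem irrotational_eigvec_of_L1 {V E T : Type*} [Fintype V] [Fintype E] [Fintype T]
    (B₁ : Matrix V E ℝ) (B₂ : Matrix E T ℝ) (h : B₁ * B₂ = 0)
    (u : V → ℝ) (lam : ℝ) (hlam : lam ≠ 0) (hu0 : u ≠ 0)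
    (hu : (B₁ * B₁ᵀ).mulVec u = lam • u) :
    B₁ᵀ.mulVec u ≠ 0 ∧
    (B₁ᵀ * B₁ + B₂ * B₂ᵀ).mulVec (B₁ᵀ.mulVec u) = lam • (B₁ᵀ.mulVec u) := by
  have hT : B₂ᵀ * B₁ᵀ = 0 := by rw [← transpose_mul, h, transpose_zero]
  rw [← mulVec_mulVec] at hu
  refine ⟨fun hv => ?_, ?_⟩
  · rw [hv, mulVec_zero] at hu
    exact smul_ne_zero hlam hu0 hu.symm
  · rw [add_mulVec, ← mulVec_mulVec, hu, mulVec_smul, mulVec_mulVec, Matrix.mul_assoc, hT,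
      Matrix.mul_zero, zero_mulVec, add_zero]
end

section
/- Let B₁ : Matrix V E ℝ and B₂ : Matrix E T ℝ satisfy B₁ * B₂ = 0, and L₁ := B₁ᵀ * B₁ + B₂ * B₂ᵀ. If u ∈ ℝ^T is nonzero and satisfies (B₂ᵀ * B₂).mulVec u = λ • u with λ ≠ 0, then w := B₂.mulVec u is nonzero and satisfies L₁.mulVec w = λ • w; that is, B₂ u is an eigenvector of the full first-order Hodge Laplacian L₁ for the same eigenvalue λ, lying in the solenoidal subspace. (Key step in the proof of Theorem 4(b).) -/
open Matrix

/-- Key step of Theorem 4(b): if `u` is an eigenvector of the second-order Laplacian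
`B₂ᵀ B₂` for a nonzero eigenvalue `λ`, then `B₂ u` is an eigenvector of the full
first-order Hodge Laplacian `L₁ = B₁ᵀ B₁ + B₂ B₂ᵀ` for the same eigenvalue. -/
theorem solenoidal_eigvec_of_L1 {V E T : Type*} [Fintype V] [Fintype E] [Fintype T]
    (B₁ : Matrix V E ℝ) (B₂ : Matrix E T ℝ) (h : B₁ * B₂ = 0)
    (u : T → ℝ) (lam : ℝ) (hlam : lam ≠ 0) (hu0 : u ≠ 0)
    (hu : (B₂ᵀ * B₂).mulVec u = lam • u) :
    B₂.mulVec u ≠ 0 ∧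
    (B₁ᵀ * B₁ + B₂ * B₂ᵀ).mulVec (B₂.mulVec u) = lam • (B₂.mulVec u) := by
  have hu' : B₂ᵀ *ᵥ (B₂ *ᵥ u) = lam • u := by rw [mulVec_mulVec, hu]
  constructor
  · intro hw
    rw [hw, mulVec_zero] at hu'
    exact smul_ne_zero hlam hu0 hu'.symm
  · have hw : B₁ *ᵥ (B₂ *ᵥ u) = 0 := by rw [mulVec_mulVec, h, zero_mulVec]
    rw [add_mulVec, ← mulVec_mulVec _ B₁ᵀ, ← mulVec_mulVec _ B₂, hw, hu', mulVec_zero,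
      zero_add, mulVec_smul]
end

section
/- Closed-form solution of the PCA-based smoothing step: let U : Matrix E F ℝ have orthonormal columns (Uᵀ * U = 1), let L : Matrix E E ℝ be symmetric positive semidefinite, let γ > 0, and let X : Matrix E M ℝ. Define g(S) := trace(Sᵀ * (Uᵀ * L * U) * S) + γ * ‖X − U * S‖_F² for S : Matrix F M ℝ, where ‖·‖_F is the Frobenius norm. Then the matrix Uᵀ * L * U + γ • 1 is invertible, and S* := γ • (Uᵀ * L * U + γ • 1)⁻¹ * Uᵀ * X is the unique global minimizer of g: for every S ≠ S*, g(S*) < g(S). -/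
open Matrix

/-- A quadratic penalized least-squares objective with symmetric `B` splits around any solution `T`
of the normal equation `B T + γ T = γ Uᵀ X`. -/
theorem penalized_objective_add {E F M : Type*} [Fintype E] [Fintype F] [Fintype M] [DecidableEq F]
    {U : Matrix E F ℝ} (hU : Uᵀ * U = 1) {B : Matrix F F ℝ} (hB : Bᵀ = B)
    {γ : ℝ} {X : Matrix E M ℝ} {T : Matrix F M ℝ} (hT : B * T + γ • T = γ • (Uᵀ * X))
    (D : Matrix F M ℝ) :
    ((T + D)ᵀ * B * (T + D)).trace + γ * ((X - U * (T + D))ᵀ * (X - U * (T + D))).trace =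
      (Tᵀ * B * T).trace + γ * ((X - U * T)ᵀ * (X - U * T)).trace +
        ((Dᵀ * B * D).trace + γ * (Dᵀ * D).trace) := by
  have hcross : (Dᵀ * B * T).trace + γ * (Dᵀ * T).trace = γ * (Dᵀ * (Uᵀ * X)).trace := by
    have h := congrArg (fun Y => (Dᵀ * Y).trace) hT
    simpa [Matrix.mul_add, Matrix.mul_assoc] using h
  have hsymm : (Tᵀ * B * D).trace = (Dᵀ * B * T).trace := by
    rw [← trace_transpose]
    simp [transpose_mul, hB, Matrix.mul_assoc]
  have hres : (X - U * (T + D))ᵀ * (X - U * (T + D)) =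
      (X - U * T)ᵀ * (X - U * T) - (X - U * T)ᵀ * (U * D) - (U * D)ᵀ * (X - U * T)
        + (U * D)ᵀ * (U * D) := by
    rw [Matrix.mul_add, ← sub_sub]
    generalize X - U * T = R
    simp only [transpose_sub, Matrix.sub_mul, Matrix.mul_sub]
    abel
  have hUU (Y : Matrix F M ℝ) : (U * D)ᵀ * (U * Y) = Dᵀ * Y := by
    rw [transpose_mul, Matrix.mul_assoc, ← Matrix.mul_assoc Uᵀ, hU, Matrix.one_mul]
  have hres_symm : ((X - U * T)ᵀ * (U * D)).trace = ((U * D)ᵀ * (X - U * T)).trace := by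
    rw [← trace_transpose, transpose_mul, transpose_transpose]
  have hres_cross : ((U * D)ᵀ * (X - U * T)).trace =
      (Dᵀ * (Uᵀ * X)).trace - (Dᵀ * T).trace := by
    rw [Matrix.mul_sub, trace_sub, hUU, transpose_mul, Matrix.mul_assoc]
  rw [hres]
  simp only [trace_add, trace_sub, transpose_add, Matrix.add_mul, Matrix.mul_add, hUU, hsymm,
    hres_symm, hres_cross]
  linear_combination 2 * hcross

/-- Closed-form solution of the PCA-based smoothing step: the strictly convex objective
`g(S) = tr(Sᵀ Uᵀ L U S) + γ ‖X − U S‖_F²` has the unique global minimizer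
`S* = γ (Uᵀ L U + γ I)⁻¹ Uᵀ X`. -/
theorem pca_smoothing_closed_form {E F M : Type*}
    [Fintype E] [Fintype F] [Fintype M] [DecidableEq F]
    (U : Matrix E F ℝ) (hU : Uᵀ * U = 1)
    (L : Matrix E E ℝ) (hL : L.PosSemidef)
    (γ : ℝ) (hγ : 0 < γ) (X : Matrix E M ℝ) :
    let g : Matrix F M ℝ → ℝ := fun S =>
      (Sᵀ * (Uᵀ * L * U) * S).trace + γ * ((X - U * S)ᵀ * (X - U * S)).trace
    let Sstar : Matrix F M ℝ := γ • (Uᵀ * L * U + γ • 1)⁻¹ * Uᵀ * X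
    IsUnit (Uᵀ * L * U + γ • 1) ∧ ∀ S, S ≠ Sstar → g Sstar < g S := by
  intro g Sstar
  have hB : (Uᵀ * L * U).PosSemidef := by
    simpa using hL.conjTranspose_mul_mul_same U
  have hA : IsUnit (Uᵀ * L * U + γ • 1) :=
    (Matrix.PosDef.posSemidef_add hB (PosDef.one.smul hγ)).isUnit
  refine ⟨hA, fun S hS => ?_⟩
  have hnormal : Uᵀ * L * U * Sstar + γ • Sstar = γ • (Uᵀ * X) := by
    have h : (Uᵀ * L * U + γ • 1) * Sstar = γ • (Uᵀ * X) := by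
      simp only [Sstar, Matrix.smul_mul, Matrix.mul_smul, Matrix.mul_assoc _ Uᵀ X]
      rw [mul_nonsing_inv_cancel_left _ _ ((isUnit_iff_isUnit_det _).mp hA)]
    simpa [Matrix.add_mul] using h
  have hg := penalized_objective_add hU (by simpa using hB.isHermitian.eq) hnormal (S - Sstar)
  rw [add_sub_cancel] at hg
  have hquad : 0 ≤ ((S - Sstar)ᵀ * (Uᵀ * L * U) * (S - Sstar)).trace := by
    simpa using (hB.conjTranspose_mul_mul_same (S - Sstar)).trace_nonneg
  have hnorm : 0 < ((S - Sstar)ᵀ * (S - Sstar)).trace := by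
    refine lt_of_le_of_ne ?_ fun h => hS (sub_eq_zero.mp ?_)
    · simpa using (posSemidef_conjTranspose_mul_self (S - Sstar)).trace_nonneg
    · exact trace_conjTranspose_mul_self_eq_zero_iff.mp (by simpa using h.symm)
  change _ < (Sᵀ * (Uᵀ * L * U) * S).trace + γ * ((X - U * S)ᵀ * (X - U * S)).trace
  rw [hg]
  exact lt_add_of_pos_right _ (add_pos_of_nonneg_of_pos hquad (mul_pos hγ hnorm))
end
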